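/- arXiv:0902.0350 — 2 statements merged into one kernel-verified Lean document; each statement's English description precedes it below -/
import Mathlib

section
/- Let S = {u, v, w} be a triangle in the plane with all side lengths at least 2, ‖u-v‖ ≤ 2.51, ‖u-w‖ ≤ 2.51, and ‖v-w‖ = 2. Let X be the set of points in the convex hull of S whose distance from each of u, v, w is at least 1.2. Then the diameter of X is less than 1.044. -/
lemma tcd_sq (d : ℝ) (h : 1.2 ≤ d) : 1.44 ≤ d ^ 2 := by nlinarith

lemma tcd_dist (u v w x y : EuclideanSpace ℝ (Fin 2)) (a b c a' b' c' : ℝ)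
    (h : a + b + c = 1) (h' : a' + b' + c' = 1)
    (hx : x = a • u + b • v + c • w) (hy : y = a' • u + b' • v + c' • w) :
    dist x y ^ 2 = -((a - a') * (b - b') * dist u v ^ 2 + (a - a') * (c - c') * dist u w ^ 2
      + (b - b') * (c - c') * dist v w ^ 2) := by
  have e : ∀ p q : EuclideanSpace ℝ (Fin 2),
      dist p q ^ 2 = (p 0 - q 0) ^ 2 + (p 1 - q 1) ^ 2 := by
    intro p q
    rw [EuclideanSpace.dist_eq, Real.sq_sqrt (by positivity), Fin.sum_univ_two,
      Real.dist_eq, Real.dist_eq, sq_abs, sq_abs]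
  obtain rfl : b = 1 - a - c := by linarith
  obtain rfl : b' = 1 - a' - c' := by linarith
  rw [e, e, e, e, hx, hy]
  simp only [PiLp.add_apply, PiLp.smul_apply, smul_eq_mul]
  ring

lemma tcd_hull (u v w x : EuclideanSpace ℝ (Fin 2))
    (hx : x ∈ convexHull ℝ ({u, v, w} : Set (EuclideanSpace ℝ (Fin 2)))) :
    ∃ a b c : ℝ, 0 ≤ a ∧ 0 ≤ b ∧ 0 ≤ c ∧ a + b + c = 1 ∧ x = a • u + b • v + c • w := by
  rw [convexHull_insert (by simp), convexHull_pair] at hx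
  simp only [convexJoin_singleton_left, Set.mem_iUnion] at hx
  obtain ⟨z, ⟨s, t, hs, ht, hst, rfl⟩, ⟨p, q, hp, hq, hpq, rfl⟩⟩ := hx
  refine ⟨p, q * s, q * t, hp, by positivity, by positivity, ?_, ?_⟩
  · rw [add_assoc, ← mul_add, hst, mul_one, hpq]
  · rw [smul_add, smul_smul, smul_smul, add_assoc]

/-- every point of the core has barycentric coordinates at most `1 - 1.2 / 2.51` -/
lemma tcd_coord (b c P Q R : ℝ) (hb : 0 ≤ b) (hc : 0 ≤ c)
    (hP : P ≤ 6.3001) (hQ : Q ≤ 6.3001) (hR : 0 ≤ R)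
    (h : 1.44 ≤ (b + c) * (b * P + c * Q) - b * c * R) : 0.478086 ≤ b + c := by
  by_contra hlt
  push Not at hlt
  have h1 : (b + c) * (b * P + c * Q) ≤ (b + c) * (b * 6.3001 + c * 6.3001) := by gcongr
  have h2 : 0 ≤ b * c * R := by positivity
  nlinarith

/-- every point of the core has height at least `√0.44` -/
lemma tcd_height (t B al be ga : ℝ) (h0 : 0 ≤ al) (h1 : 0 ≤ be) (h2 : 0 ≤ ga)
    (hs : al + be + ga = 1) (ht : -1 ≤ t) (ht' : t ≤ 1)
    (hv : 1.44 ≤ (1 + (ga - be + al * t)) ^ 2 + al ^ 2 * B)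
    (hw : 1.44 ≤ (1 - (ga - be + al * t)) ^ 2 + al ^ 2 * B) : 0.44 ≤ al ^ 2 * B := by
  have h3 : ga - be + al * t ≤ 1 := by nlinarith
  have h4 : -1 ≤ ga - be + al * t := by nlinarith
  rcases le_total 0 (ga - be + al * t) with h | h <;> nlinarith

lemma tcd_core (t B al e f : ℝ) (ht : -1 ≤ t) (hP : (1 + t) ^ 2 + B ≤ 6.3001)
    (hQ : (1 - t) ^ 2 + B ≤ 6.3001) (h0 : 0 ≤ al) (h : 0.44 ≤ al ^ 2 * B)
    (htt : t ≤ 0.576)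
    (he : 0 ≤ e) (hf : 0 ≤ f) (hef : e + f ≤ 0.521914) (hea : e + al ≤ 0.521914) :
    e ^ 2 * ((1 + t) ^ 2 + B) + 4 * f ^ 2 + e * f * (4 + 4 * t) ≤ 1.0898 := by
  have hef0 : 0 ≤ e * f := mul_nonneg he hf
  have g1 : e ^ 2 * ((1 + t) ^ 2 + B) ≤ e ^ 2 * 6.3001 := by gcongr
  have hf2 : f ≤ 0.521914 - e := by linarith
  have g2 : f ^ 2 ≤ (0.521914 - e) ^ 2 := by gcongr
  have g3 : e * f ≤ e * (0.521914 - e) := by gcongr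
  have hal2 : 0 ≤ al ^ 2 := sq_nonneg al
  rcases le_total t 0.45 with h45 | h45
  · have hB : B ≤ 5.3001 := by nlinarith
    have : 0.44 ≤ al ^ 2 * 5.3001 := h.trans (by gcongr)
    have hal : 0.288 ≤ al := by
      by_contra hlt
      push Not at hlt
      nlinarith only [this, hlt, h0]
    have g4 : e * f * (4 + 4 * t) ≤ e * (0.521914 - e) * 5.8 := by
      calc e * f * (4 + 4 * t) ≤ e * f * 5.8 := by gcongr; linarith
        _ ≤ _ := by gcongr
    have g5 : 0 ≤ e * (0.233914 - e) := mul_nonneg he (by linarith)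
    have g6 : e ≤ 0.233914 := by linarith
    nlinarith only [g1, g2, g4, g5, g6, he]
  · have hB : B ≤ 4.1976 := by nlinarith only [hP, h45]
    have : 0.44 ≤ al ^ 2 * 4.1976 := h.trans (by gcongr)
    have hal : 0.3237 ≤ al := by
      by_contra hlt
      push Not at hlt
      nlinarith only [this, hlt, h0]
    have g4 : e * f * (4 + 4 * t) ≤ e * (0.521914 - e) * 6.304 := by
      calc e * f * (4 + 4 * t) ≤ e * f * 6.304 := by gcongr; linarith
        _ ≤ _ := by gcongr
    have g5 : 0 ≤ e * (0.198214 - e) := mul_nonneg he (by linarith)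
    have g6 : e ≤ 0.198214 := by linarith
    nlinarith only [g1, g2, g4, g5, g6, he]

/-- two points of the core, the second one being at least as high as the first -/
lemma tcd_pair (t B a b c a' b' c' : ℝ) (ht : -0.576 ≤ t) (ht' : t ≤ 0.576)
    (hP : (1 + t) ^ 2 + B ≤ 6.3001) (hQ : (1 - t) ^ 2 + B ≤ 6.3001)
    (ha : 0 ≤ a) (hb : 0 ≤ b) (hc : 0 ≤ c) (hb' : 0 ≤ b') (hc' : 0 ≤ c')
    (hs : a + b + c = 1) (hs' : a' + b' + c' = 1)
    (hB : 0.44 ≤ a ^ 2 * B) (h1 : 0.478086 ≤ b' + c') (h2 : 0.478086 ≤ a + c)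
    (h3 : 0.478086 ≤ a + b) (h4 : 0.478086 ≤ a' + c') (h5 : 0.478086 ≤ a' + b')
    (hle : a ≤ a') :
    -((a - a') * (b - b') * ((1 + t) ^ 2 + B) + (a - a') * (c - c') * ((1 - t) ^ 2 + B)
      + (b - b') * (c - c') * 4) ≤ 1.0898 := by
  rcases le_total c c' with h | h
  · have := tcd_core t B a (a' - a) (c' - c) (by linarith) hP hQ ha hB ht' (by linarith)
      (by linarith) (by linarith) (by linarith)
    obtain rfl : b = 1 - a - c := by linarith
    obtain rfl : b' = 1 - a' - c' := by linarith
    linarith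
  rcases le_total b b' with g | g
  · have := tcd_core (-t) B a (a' - a) (b' - b) (by linarith) (by linarith) (by linarith) ha hB
      (by linarith) (by linarith) (by linarith) (by linarith) (by linarith)
    obtain rfl : c = 1 - a - b := by linarith
    obtain rfl : c' = 1 - a' - b' := by linarith
    linarith
  · have hB1 : B ≤ 5.3001 := by nlinarith
    have : 0.44 ≤ a ^ 2 * 5.3001 := hB.trans (by gcongr)
    have hal : 0.288 ≤ a := by
      by_contra hlt
      push Not at hlt
      nlinarith only [this, hlt, ha]
    have k1 : (a' - a) * (b - b') * ((1 + t) ^ 2 + B) ≤ (a' - a) * (b - b') * 6.3001 := by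
      have : 0 ≤ (a' - a) * (b - b') := mul_nonneg (by linarith) (by linarith)
      gcongr
    have k2 : (a' - a) * (c - c') * ((1 - t) ^ 2 + B) ≤ (a' - a) * (c - c') * 6.3001 := by
      have : 0 ≤ (a' - a) * (c - c') := mul_nonneg (by linarith) (by linarith)
      gcongr
    have k3 : 0 ≤ (b - b') * (c - c') := mul_nonneg (by linarith) (by linarith)
    have k4 : (a' - a) * (b - b') + (a' - a) * (c - c') = (a' - a) ^ 2 := by
      rw [← mul_add, show (b - b') + (c - c') = a' - a by linarith]; ring
    have k5 : (a' - a) ^ 2 ≤ 0.234 ^ 2 := by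
      have : 0 ≤ a' - a := by linarith
      gcongr; linarith
    linarith

theorem triangle_core_diameter (u v w : EuclideanSpace ℝ (Fin 2))
    (huv2 : 2 ≤ dist u v) (huw2 : 2 ≤ dist u w) (hvw2 : 2 ≤ dist v w)
    (huv : dist u v ≤ 2.51) (huw : dist u w ≤ 2.51) (hvw : dist v w = 2) :
    Metric.diam {x ∈ convexHull ℝ ({u, v, w} : Set (EuclideanSpace ℝ (Fin 2))) |
      1.2 ≤ dist x u ∧ 1.2 ≤ dist x v ∧ 1.2 ≤ dist x w} < 1.044 := by
  have hP : dist u v ^ 2 ≤ 6.3001 := by nlinarith only [huv, huv2]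
  have hQ : dist u w ^ 2 ≤ 6.3001 := by nlinarith only [huw, huw2]
  have hP4 : 4 ≤ dist u v ^ 2 := by nlinarith only [huv2]
  have hQ4 : 4 ≤ dist u w ^ 2 := by nlinarith only [huw2]
  have hR : dist v w ^ 2 = 4 := by rw [hvw]; norm_num
  obtain ⟨t, ht⟩ : ∃ t, t = (dist u v ^ 2 - dist u w ^ 2) / 4 := ⟨_, rfl⟩
  obtain ⟨B, hB⟩ : ∃ B, B = dist u v ^ 2 - (1 + t) ^ 2 := ⟨_, rfl⟩
  have eP : dist u v ^ 2 = (1 + t) ^ 2 + B := by linarith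
  have eQ : dist u w ^ 2 = (1 - t) ^ 2 + B := by linarith
  have ht1 : -0.576 ≤ t := by linarith
  have ht2 : t ≤ 0.576 := by linarith
  have key : ∀ x ∈ {x ∈ convexHull ℝ ({u, v, w} : Set (EuclideanSpace ℝ (Fin 2))) |
      1.2 ≤ dist x u ∧ 1.2 ≤ dist x v ∧ 1.2 ≤ dist x w}, ∃ a b c : ℝ,
      0 ≤ a ∧ 0 ≤ b ∧ 0 ≤ c ∧ a + b + c = 1 ∧ x = a • u + b • v + c • w ∧
      0.44 ≤ a ^ 2 * B ∧ 0.478086 ≤ b + c ∧ 0.478086 ≤ a + c ∧ 0.478086 ≤ a + b := by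
    rintro x ⟨hx, hu, hv, hw⟩
    obtain ⟨a, b, c, ha, hb, hc, hs, hxe⟩ := tcd_hull u v w x hx
    have du := tcd_dist u v w x u a b c 1 0 0 hs (by norm_num) hxe (by simp)
    have dv := tcd_dist u v w x v a b c 0 1 0 hs (by norm_num) hxe (by simp)
    have dw := tcd_dist u v w x w a b c 0 0 1 hs (by norm_num) hxe (by simp)
    have eu : 1.44 ≤ dist x u ^ 2 := tcd_sq _ hu
    have ev : 1.44 ≤ dist x v ^ 2 := tcd_sq _ hv
    have ew : 1.44 ≤ dist x w ^ 2 := tcd_sq _ hw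
    rw [du, hR] at eu
    rw [dv, hR] at ev
    rw [dw, hR] at ew
    refine ⟨a, b, c, ha, hb, hc, hs, hxe, ?_, ?_, ?_, ?_⟩
    · rw [eP, eQ] at ev ew
      apply tcd_height t B a b c ha hb hc hs (by linarith) (by linarith)
      · obtain rfl : b = 1 - a - c := by linarith
        linarith
      · obtain rfl : b = 1 - a - c := by linarith
        linarith
    · apply tcd_coord b c (dist u v ^ 2) (dist u w ^ 2) 4 hb hc hP hQ (by norm_num)
      obtain rfl : a = 1 - b - c := by linarith
      linarith
    · apply tcd_coord a c (dist u v ^ 2) 4 (dist u w ^ 2) ha hc hP (by norm_num) (by positivity)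
      obtain rfl : b = 1 - a - c := by linarith
      linarith
    · apply tcd_coord a b (dist u w ^ 2) 4 (dist u v ^ 2) ha hb hQ (by norm_num) (by positivity)
      obtain rfl : c = 1 - a - b := by linarith
      linarith
  refine lt_of_le_of_lt (Metric.diam_le_of_forall_dist_le (C := 1.04395) (by norm_num) ?_)
    (by norm_num)
  intro x hx y hy
  obtain ⟨a, b, c, ha, hb, hc, hs, hxe, hh, h1, h2, h3⟩ := key x hx
  obtain ⟨a', b', c', ha', hb', hc', hs', hye, hh', h1', h2', h3'⟩ := key y hy
  have hd : dist x y ^ 2 ≤ 1.0898 := by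
    rcases le_total a a' with hle | hle
    · rw [tcd_dist u v w x y a b c a' b' c' hs hs' hxe hye, hR, eP, eQ]
      exact tcd_pair t B a b c a' b' c' ht1 ht2 (by linarith) (by linarith) ha hb hc hb' hc'
        hs hs' hh h1' h2 h3 h2' h3' hle
    · rw [dist_comm, tcd_dist u v w y x a' b' c' a b c hs' hs hye hxe, hR, eP, eQ]
      exact tcd_pair t B a' b' c' a b c ht1 ht2 (by linarith) (by linarith) ha' hb' hc' hb hc
        hs' hs hh' h1 h2' h3' h2 h3 hle
  by_contra hlt
  push Not at hlt
  nlinarith only [hd, hlt]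
end

section
/- (Combined crossing lemma, Lemma 7small) Let S = {0, v, w, u1, u2, u1', u2'} ⊂ R^3 be seven distinct points with pairwise distances at least 2, ‖u‖ ≤ 2.51 for all u ∈ S, ‖v-w‖ = 2, ‖u1-u2‖ ≤ 3.2, ‖u1'-u2'‖ ≤ 3.2, and suppose both segments [u1,u2] and [u1',u2'] pass through (intersect the interior of) the triangle with vertices {0,v,w}. Then there exist a point p on the segment [u1,u2] and a point p' on [u1',u2'] with ‖p-p'‖ < 1.044. -/
/-- Polygon bound at a corner of the parameter box. -/
lemma quad_corner (A B b g : ℝ) (hA : A = 4 ∨ A = 6.3001) (hB : B = 4 ∨ B = 6.3001)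
    (hb : 0 ≤ b) (hbg : b ≤ g) (h0 : 1.2 ≤ 2.51 * (b + g))
    (hw : 1.2 ≤ 2.51 * (1 - b - g) + 2 * b) (ha : 0.288 ≤ 1 - b - g) :
    (b - 0.261) ^ 2 * A + (g - 0.261) ^ 2 * B
      + (b - 0.261) * (g - 0.261) * (A + B - 4) < 0.272484 := by
  rcases hA with rfl | rfl <;> rcases hB with rfl | rfl <;>
  nlinarith [mul_nonneg hb (sub_nonneg.2 hbg), mul_nonneg hb (sub_nonneg.2 h0),
    mul_nonneg hb (sub_nonneg.2 hw), mul_nonneg hb (sub_nonneg.2 ha),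
    mul_nonneg (sub_nonneg.2 hbg) (sub_nonneg.2 h0),
    mul_nonneg (sub_nonneg.2 hbg) (sub_nonneg.2 hw),
    mul_nonneg (sub_nonneg.2 hbg) (sub_nonneg.2 ha),
    mul_nonneg (sub_nonneg.2 h0) (sub_nonneg.2 hw),
    mul_nonneg (sub_nonneg.2 h0) (sub_nonneg.2 ha),
    mul_nonneg (sub_nonneg.2 hw) (sub_nonneg.2 ha)]

/-- An affine function on an interval is bounded by its endpoint values. -/
lemma affine_lt (X Y c A : ℝ) (h1 : 4 ≤ A) (h2 : A ≤ 6.3001)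
    (e1 : X * 4 + Y < c) (e2 : X * 6.3001 + Y < c) : X * A + Y < c := by
  rcases le_total 0 X with h | h
  · nlinarith
  · nlinarith

lemma quad_box (A B b g : ℝ) (hA : 4 ≤ A) (hA' : A ≤ 6.3001) (hB : 4 ≤ B) (hB' : B ≤ 6.3001)
    (hb : 0 ≤ b) (hbg : b ≤ g) (h0 : 1.2 ≤ 2.51 * (b + g))
    (hw : 1.2 ≤ 2.51 * (1 - b - g) + 2 * b) (ha : 0.288 ≤ 1 - b - g) :
    (b - 0.261) ^ 2 * A + (g - 0.261) ^ 2 * B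
      + (b - 0.261) * (g - 0.261) * (A + B - 4) < 0.272484 := by
  have key : ∀ A' : ℝ, (A' = 4 ∨ A' = 6.3001) → (b - 0.261) ^ 2 * A' + (g - 0.261) ^ 2 * B
      + (b - 0.261) * (g - 0.261) * (A' + B - 4) < 0.272484 := by
    intro A' h
    have e1 := quad_corner A' 4 b g h (Or.inl rfl) hb hbg h0 hw ha
    have e2 := quad_corner A' 6.3001 b g h (Or.inr rfl) hb hbg h0 hw ha
    have := affine_lt ((g - 0.261) ^ 2 + (b - 0.261) * (g - 0.261))
      ((b - 0.261) ^ 2 * A' + (b - 0.261) * (g - 0.261) * (A' - 4)) 0.272484 B hB hB'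
      (by linarith) (by linarith)
    linarith
  have e1 := key 4 (Or.inl rfl)
  have e2 := key 6.3001 (Or.inr rfl)
  have := affine_lt ((b - 0.261) ^ 2 + (b - 0.261) * (g - 0.261))
      ((g - 0.261) ^ 2 * B + (b - 0.261) * (g - 0.261) * (B - 4)) 0.272484 A hA hA'
      (by linarith) (by linarith)
  linarith

/-- Height bound: both distances from `v`, `w` at least 1.2. -/
lemma height_bound (A B b g : ℝ) (hA : 4 ≤ A) (hA' : A ≤ 6.3001) (hB : 4 ≤ B) (hB' : B ≤ 6.3001)
    (hb : 0 ≤ b) (hg : 0 ≤ g) (ha : 0 ≤ 1 - b - g)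
    (gw : 1.44 ≤ 4 * b ^ 2 + (1 - b - g) ^ 2 * B + (1 - b - g) * b * (B + 4 - A))
    (gv : 1.44 ≤ 4 * g ^ 2 + (1 - b - g) ^ 2 * A + (1 - b - g) * g * (A + 4 - B)) :
    0.288 ≤ 1 - b - g := by
  obtain ⟨c, hc⟩ : ∃ c : ℝ, c = (A - B) / 4 := ⟨_, rfl⟩
  obtain ⟨x, hx⟩ : ∃ x : ℝ, x = g - b + (1 - b - g) * c := ⟨_, rfl⟩
  obtain ⟨H, hH⟩ : ∃ H : ℝ, H = (A + B) / 2 - 1 - c ^ 2 := ⟨_, rfl⟩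
  have ew : 4 * b ^ 2 + (1 - b - g) ^ 2 * B + (1 - b - g) * b * (B + 4 - A)
      = (1 - x) ^ 2 + (1 - b - g) ^ 2 * H := by
    rw [hx, hH, hc]; ring
  have ev : 4 * g ^ 2 + (1 - b - g) ^ 2 * A + (1 - b - g) * g * (A + 4 - B)
      = (1 + x) ^ 2 + (1 - b - g) ^ 2 * H := by
    rw [hx, hH, hc]; ring
  have hc1 : c ≤ 1 := by rw [hc]; linarith
  have hc2 : -1 ≤ c := by rw [hc]; linarith
  have hH2 : H ≤ 5.3001 := by nlinarith [sq_nonneg c]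
  have x1 : x ≤ 1 := by nlinarith [mul_nonneg ha (sub_nonneg.2 hc1)]
  have x2 : -1 ≤ x := by nlinarith [mul_nonneg ha (sub_nonneg.2 hc2)]
  have hy : 0.44 ≤ (1 - b - g) ^ 2 * H := by
    rw [ew] at gw
    rw [ev] at gv
    rcases le_total 0 x with h | h
    · have : (1 - x) ^ 2 ≤ 1 := pow_le_one₀ (by linarith) (by linarith)
      linarith
    · have : (1 + x) ^ 2 ≤ 1 := pow_le_one₀ (by linarith) (by linarith)
      linarith
  have h5 : 0.44 ≤ (1 - b - g) ^ 2 * 5.3001 :=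
    hy.trans (mul_le_mul_of_nonneg_left hH2 (sq_nonneg _))
  by_contra hcon
  push Not at hcon
  have h6 : (1 - b - g) ^ 2 ≤ 0.288 ^ 2 := pow_le_pow_left₀ ha hcon.le 2
  linarith

/-- The half with `b ≤ g`. -/
lemma half_bound (A B b g : ℝ) (hA : 4 ≤ A) (hA' : A ≤ 6.3001) (hB : 4 ≤ B) (hB' : B ≤ 6.3001)
    (hb : 0 ≤ b) (hbg : b ≤ g) (ha : 0 ≤ 1 - b - g)
    (g0 : 1.44 ≤ b ^ 2 * A + g ^ 2 * B + b * g * (A + B - 4))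
    (gw : 1.44 ≤ 4 * b ^ 2 + (1 - b - g) ^ 2 * B + (1 - b - g) * b * (B + 4 - A))
    (gv : 1.44 ≤ 4 * g ^ 2 + (1 - b - g) ^ 2 * A + (1 - b - g) * g * (A + 4 - B)) :
    (b - 0.261) ^ 2 * A + (g - 0.261) ^ 2 * B
      + (b - 0.261) * (g - 0.261) * (A + B - 4) < 0.272484 := by
  have hg : 0 ≤ g := hb.trans hbg
  refine quad_box A B b g hA hA' hB hB' hb hbg ?_ ?_ (height_bound A B b g hA hA' hB hB' hb hg ha gw gv)
  · apply le_of_sq_le_sq _ (by positivity)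
    have h1 := mul_le_mul_of_nonneg_left hA' (sq_nonneg b)
    have h2 := mul_le_mul_of_nonneg_left hB' (sq_nonneg g)
    have h3 := mul_le_mul_of_nonneg_left (show A + B - 4 ≤ 12.6002 by linarith) (mul_nonneg hb hg)
    nlinarith
  · apply le_of_sq_le_sq _ (by positivity)
    have h1 := mul_le_mul_of_nonneg_left hB' (sq_nonneg (1 - b - g))
    have h3 := mul_le_mul_of_nonneg_left (show B + 4 - A ≤ 10.04 by linarith) (mul_nonneg ha hb)
    nlinarith

abbrev E3 := EuclideanSpace ℝ (Fin 3)

lemma seg_dist (x u1 u2 p : E3) (h1 : 2 ≤ ‖u1 - x‖) (h2 : 2 ≤ ‖u2 - x‖)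
    (h12 : ‖u1 - u2‖ ≤ 3.2) (hp : p ∈ segment ℝ u1 u2) : 1.44 ≤ ‖p - x‖ ^ 2 := by
  obtain ⟨s, t, hs, ht, hst, rfl⟩ := hp
  have e0 : s • u1 + t • u2 - x = s • (u1 - x) + t • (u2 - x) := by
    have : x = (s + t) • x := by rw [hst, one_smul]
    nth_rewrite 1 [this]
    module
  have e1 : u1 - u2 = (u1 - x) - (u2 - x) := by abel
  rw [e0]
  rw [e1] at h12
  generalize u1 - x = a at *
  generalize u2 - x = b at *
  have h3 : ‖a - b‖ ^ 2 ≤ 10.24 := by nlinarith [norm_nonneg (a - b)]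
  rw [norm_sub_sq_real] at h3
  rw [norm_add_sq_real, norm_smul, norm_smul, inner_smul_left, inner_smul_right,
    Real.norm_of_nonneg hs, Real.norm_of_nonneg ht]
  simp only [conj_trivial]
  have ha : 4 ≤ ‖a‖ ^ 2 := by nlinarith
  have hb : 4 ≤ ‖b‖ ^ 2 := by nlinarith
  obtain rfl : t = 1 - s := by linarith
  have k1 := mul_le_mul_of_nonneg_left h3 (mul_nonneg hs ht)
  have k2 := mul_le_mul_of_nonneg_left ha hs
  have k3 := mul_le_mul_of_nonneg_left hb ht
  nlinarith [sq_nonneg (s - 1/2)]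

lemma norm_comb (v w : E3) (hvw : ‖v - w‖ = 2) (s t : ℝ) :
    ‖s • v + t • w‖ ^ 2 = s ^ 2 * ‖v‖ ^ 2 + t ^ 2 * ‖w‖ ^ 2
      + s * t * (‖v‖ ^ 2 + ‖w‖ ^ 2 - 4) := by
  have h : ‖v - w‖ ^ 2 = 4 := by rw [hvw]; norm_num
  rw [norm_sub_sq_real] at h
  rw [norm_add_sq_real, norm_smul, norm_smul, inner_smul_left, inner_smul_right, mul_pow, mul_pow,
    Real.norm_eq_abs, Real.norm_eq_abs, sq_abs, sq_abs]
  simp only [conj_trivial]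
  linear_combination (-(s * t)) * h

lemma near_center (v w u1 u2 p : E3) (hvw : ‖v - w‖ = 2)
    (hv : 2 ≤ ‖v‖) (hv' : ‖v‖ ≤ 2.51) (hw : 2 ≤ ‖w‖) (hw' : ‖w‖ ≤ 2.51)
    (a1 : 2 ≤ ‖u1 - 0‖) (a2 : 2 ≤ ‖u2 - 0‖) (b1 : 2 ≤ ‖u1 - v‖) (b2 : 2 ≤ ‖u2 - v‖)
    (c1 : 2 ≤ ‖u1 - w‖) (c2 : 2 ≤ ‖u2 - w‖) (h12 : ‖u1 - u2‖ ≤ 3.2)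
    (hp : p ∈ segment ℝ u1 u2) (hT : p ∈ convexHull ℝ ({0, v, w} : Set E3)) :
    ‖p - (0.261 : ℝ) • (v + w)‖ < 0.522 := by
  have g0 := seg_dist 0 u1 u2 p a1 a2 h12 hp
  have gv := seg_dist v u1 u2 p b1 b2 h12 hp
  have gw := seg_dist w u1 u2 p c1 c2 h12 hp
  obtain ⟨a, b, g, ha, hb, hg, hs, rfl⟩ : ∃ a b g : ℝ, 0 ≤ a ∧ 0 ≤ b ∧ 0 ≤ g ∧ a + b + g = 1 ∧
      b • v + g • w = p := by
    rw [convexHull_insert (by simp), convexHull_pair, mem_convexJoin] at hT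
    obtain ⟨x, hx, y, ⟨s, t, hs, ht, hst, rfl⟩, ⟨s', t', hs', ht', hst', rfl⟩⟩ := hT
    rw [Set.mem_singleton_iff] at hx
    subst hx
    refine ⟨s', t' * s, t' * t, hs', by positivity, by positivity, ?_, ?_⟩
    · linear_combination hst' + t' * hst
    · module
  obtain rfl : a = 1 - b - g := by linarith
  have e0 : b • v + g • w - 0 = b • v + g • w := by module
  have ev : b • v + g • w - v = (b - 1) • v + g • w := by module
  have ew : b • v + g • w - w = b • v + (g - 1) • w := by module
  have eo : b • v + g • w - (0.261 : ℝ) • (v + w) = (b - 0.261) • v + (g - 0.261) • w := by module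
  rw [e0, norm_comb v w hvw] at g0
  rw [ev, norm_comb v w hvw] at gv
  rw [ew, norm_comb v w hvw] at gw
  apply lt_of_pow_lt_pow_left₀ 2 (by norm_num)
  rw [eo, norm_comb v w hvw]
  have hA : 4 ≤ ‖v‖ ^ 2 := by nlinarith
  have hA' : ‖v‖ ^ 2 ≤ 6.3001 := by nlinarith
  have hB : 4 ≤ ‖w‖ ^ 2 := by nlinarith
  have hB' : ‖w‖ ^ 2 ≤ 6.3001 := by nlinarith
  generalize ‖v‖ ^ 2 = A at *
  generalize ‖w‖ ^ 2 = B at *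
  rcases le_total b g with h | h
  · have := half_bound A B b g hA hA' hB hB' hb h ha g0 (by linarith) (by linarith)
    linarith
  · have := half_bound B A g b hB hB' hA hA' hg h (by linarith) (by linarith)
      (by linarith) (by linarith)
    linarith

theorem crossing_segments_close (v w u1 u2 u1' u2' : EuclideanSpace ℝ (Fin 3))
    (hpair : List.Pairwise (fun a b => 2 ≤ dist a b)
      [(0 : EuclideanSpace ℝ (Fin 3)), v, w, u1, u2, u1', u2'])
    (hnorm : ∀ u ∈ ({0, v, w, u1, u2, u1', u2'} : Set (EuclideanSpace ℝ (Fin 3))),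
      ‖u‖ ≤ 2.51)
    (hvw : ‖v - w‖ = 2)
    (h12 : ‖u1 - u2‖ ≤ 3.2) (h12' : ‖u1' - u2'‖ ≤ 3.2)
    (hcross : (segment ℝ u1 u2 ∩
        convexHull ℝ ({0, v, w} : Set (EuclideanSpace ℝ (Fin 3)))).Nonempty)
    (hcross' : (segment ℝ u1' u2' ∩
        convexHull ℝ ({0, v, w} : Set (EuclideanSpace ℝ (Fin 3)))).Nonempty) :
    ∃ p ∈ segment ℝ u1 u2, ∃ p' ∈ segment ℝ u1' u2', ‖p - p'‖ < 1.044 := by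
  obtain ⟨p, hp, hpT⟩ := hcross
  obtain ⟨p', hp', hpT'⟩ := hcross'
  have hv' : ‖v‖ ≤ 2.51 := hnorm v (by simp)
  have hw' : ‖w‖ ≤ 2.51 := hnorm w (by simp)
  have hsymm : ∀ {x y : E3}, 2 ≤ dist x y → 2 ≤ ‖y - x‖ := by
    intro x y h
    rwa [dist_comm, dist_eq_norm] at h
  simp only [List.pairwise_cons, List.mem_cons, List.not_mem_nil, or_false, forall_eq_or_imp,
    forall_eq] at hpair
  obtain ⟨⟨d1, d2, d3, d4, d5, d6⟩, ⟨_, e3, e4, e5, e6⟩, ⟨f3, f4, f5, f6⟩, _⟩ := hpair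
  have hv : 2 ≤ ‖v‖ := by simpa using hsymm d1
  have hw : 2 ≤ ‖w‖ := by simpa using hsymm d2
  have n1 := near_center v w u1 u2 p hvw hv hv' hw hw' (hsymm d3) (hsymm d4) (hsymm e3) (hsymm e4)
    (hsymm f3) (hsymm f4) h12 hp hpT
  have n2 := near_center v w u1' u2' p' hvw hv hv' hw hw' (hsymm d5) (hsymm d6) (hsymm e5)
    (hsymm e6) (hsymm f5) (hsymm f6) h12' hp' hpT'
  refine ⟨p, hp, p', hp', ?_⟩
  have := norm_sub_le (p - (0.261 : ℝ) • (v + w)) (p' - (0.261 : ℝ) • (v + w))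
  rw [sub_sub_sub_cancel_right] at this
  linarith
end
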